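/- arXiv:1111.3043 — 2 statements merged into one kernel-verified Lean document; each statement's English description precedes it below -/
import Mathlib

section
/- (Discrete Green formula, one-dimensional central form.) For any doubled-grid functions U, V: [U_{f.} + U_{b.}, V]_{1,1}^{2N−1,2N−1} = −(U, V_{c.})_c + (h/2) Σ_{l=1}^{2N−1} [ (U_{2N−1,l} + U_{2N,l}) V_{2N,l} − (U_{0,l} + U_{1,l}) V_{0,l} ], and symmetrically [U_{.f} + U_{.b}, V]_{1,1}^{2N−1,2N−1} = −(U, V_{.c})_c + (h/2) Σ_{k=1}^{2N−1} [ (U_{k,2N−1} + U_{k,2N}) V_{k,2N} − (U_{k,0} + U_{k,1}) V_{k,0} ]. -/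
noncomputable section

/-- Forward difference in the first index: `F_{f.,kl} = 2(F_{k+1,l} - F_{kl})/h`. -/
def fd1 (h : ℝ) (F : ℕ → ℕ → ℝ) (k l : ℕ) : ℝ := 2 * (F (k + 1) l - F k l) / h

/-- Backward difference in the first index: `F_{b.,kl} = 2(F_{kl} - F_{k-1,l})/h`. -/
def bd1 (h : ℝ) (F : ℕ → ℕ → ℝ) (k l : ℕ) : ℝ := 2 * (F k l - F (k - 1) l) / h

/-- Forward difference in the second index: `F_{.f,kl} = 2(F_{k,l+1} - F_{kl})/h`. -/
def fd2 (h : ℝ) (F : ℕ → ℕ → ℝ) (k l : ℕ) : ℝ := 2 * (F k (l + 1) - F k l) / h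

/-- Backward difference in the second index: `F_{.b,kl} = 2(F_{kl} - F_{k,l-1})/h`. -/
def bd2 (h : ℝ) (F : ℕ → ℕ → ℝ) (k l : ℕ) : ℝ := 2 * (F k l - F k (l - 1)) / h

/-- Central difference in the first index: `F_{c.} = (F_{f.} + F_{b.})/2`. -/
def cd1 (h : ℝ) (F : ℕ → ℕ → ℝ) (k l : ℕ) : ℝ := (fd1 h F k l + bd1 h F k l) / 2

/-- Central difference in the second index: `F_{.c} = (F_{.f} + F_{.b})/2`. -/
def cd2 (h : ℝ) (F : ℕ → ℕ → ℝ) (k l : ℕ) : ℝ := (fd2 h F k l + bd2 h F k l) / 2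

/-- The bracket `[F,G]_{p,q}^{P,Q} = (h²/4) Σ_{k=p}^{P} Σ_{l=q}^{Q} F_{kl} G_{kl}`. -/
def brk (h : ℝ) (F G : ℕ → ℕ → ℝ) (p q P Q : ℕ) : ℝ :=
  h ^ 2 / 4 * ∑ k ∈ Finset.Icc p P, ∑ l ∈ Finset.Icc q Q, F k l * G k l

/-- The inner product `(F,G)_h = [F,G]_{1,1}^{2N-1,2N-1}`. -/
def iph (h : ℝ) (N : ℕ) (F G : ℕ → ℕ → ℝ) : ℝ :=
  brk h F G 1 1 (2 * N - 1) (2 * N - 1)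

/-- The complementary product
`(F, G_{c.})_c = [F, G_{f.}]_{0,1}^{2N-1,2N-1} + [F, G_{b.}]_{1,1}^{2N,2N-1}`. -/
def cdot1 (h : ℝ) (N : ℕ) (F G : ℕ → ℕ → ℝ) : ℝ :=
  brk h F (fd1 h G) 0 1 (2 * N - 1) (2 * N - 1) + brk h F (bd1 h G) 1 1 (2 * N) (2 * N - 1)

/-- The complementary product
`(F, G_{.c})_c = [F, G_{.f}]_{1,0}^{2N-1,2N-1} + [F, G_{.b}]_{1,1}^{2N-1,2N}`. -/
def cdot2 (h : ℝ) (N : ℕ) (F G : ℕ → ℕ → ℝ) : ℝ :=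
  brk h F (fd2 h G) 1 0 (2 * N - 1) (2 * N - 1) + brk h F (bd2 h G) 1 1 (2 * N - 1) (2 * N)

open Finset in
/-- Summation by parts for the sum of the forward and backward differences of a sequence. -/
theorem sum_forward_add_backward_mul (h : ℝ) (u v : ℕ → ℝ) (n : ℕ) :
    ∑ k ∈ Icc 1 n, (2 * (u (k + 1) - u k) / h + 2 * (u k - u (k - 1)) / h) * v k =
      -(∑ k ∈ Icc 0 n, u k * (2 * (v (k + 1) - v k) / h) +
          ∑ k ∈ Icc 1 (n + 1), u k * (2 * (v k - v (k - 1)) / h)) +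
        2 / h * ((u n + u (n + 1)) * v (n + 1) - (u 0 + u 1) * v 0) := by
  induction n with
  | zero => simp; ring
  | succ n ih =>
    rw [sum_Icc_succ_top (by lia), ih, sum_Icc_succ_top (b := n) (by lia : 0 ≤ n + 1),
      sum_Icc_succ_top (b := n + 1) (by lia)]
    simp only [Nat.add_sub_cancel]
    ring

/-- **Discrete Green formula, one-dimensional central form.** -/
theorem discrete_green_central_1d (N : ℕ) (hN : 1 ≤ N) (h : ℝ) (hh : 0 < h)
    (U V : ℕ → ℕ → ℝ) :
    brk h (fun k l => fd1 h U k l + bd1 h U k l) V 1 1 (2 * N - 1) (2 * N - 1) =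
      -cdot1 h N U V +
        h / 2 * ∑ l ∈ Finset.Icc 1 (2 * N - 1),
          ((U (2 * N - 1) l + U (2 * N) l) * V (2 * N) l - (U 0 l + U 1 l) * V 0 l) ∧
    brk h (fun k l => fd2 h U k l + bd2 h U k l) V 1 1 (2 * N - 1) (2 * N - 1) =
      -cdot2 h N U V +
        h / 2 * ∑ k ∈ Finset.Icc 1 (2 * N - 1),
          ((U k (2 * N - 1) + U k (2 * N)) * V k (2 * N) - (U k 0 + U k 1) * V k 0) := by
  obtain ⟨n, hn⟩ : ∃ n, 2 * N = n + 1 := ⟨2 * N - 1, by lia⟩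
  have hc : h ^ 2 / 4 * (2 / h) = h / 2 := by field_simp; norm_num
  simp only [hn, Nat.add_sub_cancel, cdot1, cdot2, brk, fd1, bd1, fd2, bd2]
  constructor
  · rw [Finset.sum_comm, Finset.sum_comm (s := Finset.Icc 0 n),
      Finset.sum_comm (s := Finset.Icc 1 (n + 1)),
      Finset.sum_congr rfl fun l _ =>
        sum_forward_add_backward_mul h (fun k => U k l) (fun k => V k l) n,
      Finset.sum_add_distrib, Finset.sum_neg_distrib, Finset.sum_add_distrib,
      ← Finset.mul_sum, ← hc]
    ring
  · rw [Finset.sum_congr rfl fun k _ => sum_forward_add_backward_mul h (U k) (V k) n,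
      Finset.sum_add_distrib, Finset.sum_neg_distrib, Finset.sum_add_distrib,
      ← Finset.mul_sum, ← hc]
    ring

end
end

section
/- (Discrete Green formula.) For any doubled-grid functions U, V: [U_{f.} + U_{b.}, V]_{1,1}^{2N−1,2N−1} + [U_{.f} + U_{.b}, V]_{1,1}^{2N−1,2N−1} = −(U, ∇ʰV)_c + (h/2) Σ_{l=1}^{2N−1} [ (U_{2N−1,l} + U_{2N,l}) V_{2N,l} − (U_{0,l} + U_{1,l}) V_{0,l} ] + (h/2) Σ_{k=1}^{2N−1} [ (U_{k,2N−1} + U_{k,2N}) V_{k,2N} − (U_{k,0} + U_{k,1}) V_{k,0} ]. Note that the left-hand side equals 2[(U_{c.}, V)_h + (U_{.c}, V)_h]. -/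
noncomputable section

theorem sum_fwd_add_bwd_diff_mul (u v : ℕ → ℝ) (M : ℕ) :
    ∑ k ∈ Finset.Icc 1 M, ((u (k + 1) - u k) + (u k - u (k - 1))) * v k =
      -(∑ k ∈ Finset.Icc 0 M, u k * (v (k + 1) - v k) +
        ∑ k ∈ Finset.Icc 1 (M + 1), u k * (v k - v (k - 1))) +
      ((u M + u (M + 1)) * v (M + 1) - (u 0 + u 1) * v 0) := by
  induction M with
  | zero => simp; ring
  | succ M ih =>
    rw [Finset.sum_Icc_succ_top (by omega), ih, Finset.sum_Icc_succ_top (Nat.zero_le (M + 1)),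
      Finset.sum_Icc_succ_top (b := M + 1) (by omega)]
    simp only [Nat.add_sub_cancel]
    ring

theorem brk_transpose (h : ℝ) (F G : ℕ → ℕ → ℝ) (p q P Q : ℕ) :
    brk h F G p q P Q = brk h (fun k l => F l k) (fun k l => G l k) q p Q P := by
  unfold brk
  rw [Finset.sum_comm]

/-- Summation by parts in the first index. -/
theorem brk_fd1_add_bd1 {h : ℝ} (hh : h ≠ 0) (U V : ℕ → ℕ → ℝ) (M q Q : ℕ) :
    brk h (fun k l => fd1 h U k l + bd1 h U k l) V 1 q M Q =
      -(brk h U (fd1 h V) 0 q M Q + brk h U (bd1 h V) 1 q (M + 1) Q) +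
        h / 2 * ∑ l ∈ Finset.Icc q Q,
          ((U M l + U (M + 1) l) * V (M + 1) l - (U 0 l + U 1 l) * V 0 l) := by
  simp only [brk_transpose h _ _ _ q]
  simp only [brk, ← mul_add, ← mul_neg, ← Finset.sum_add_distrib, ← Finset.sum_neg_distrib]
  rw [Finset.mul_sum, Finset.mul_sum, Finset.mul_sum, ← Finset.sum_add_distrib]
  refine Finset.sum_congr rfl fun l _ => ?_
  have e₁ (k : ℕ) : (fd1 h U k l + bd1 h U k l) * V k l =
      2 / h * (((U (k + 1) l - U k l) + (U k l - U (k - 1) l)) * V k l) := by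
    unfold fd1 bd1; ring
  have e₂ (k : ℕ) : U k l * fd1 h V k l = 2 / h * (U k l * (V (k + 1) l - V k l)) := by
    unfold fd1; ring
  have e₃ (k : ℕ) : U k l * bd1 h V k l = 2 / h * (U k l * (V k l - V (k - 1) l)) := by
    unfold bd1; ring
  simp only [e₁, e₂, e₃, ← Finset.mul_sum]
  rw [sum_fwd_add_bwd_diff_mul (fun k => U k l) (fun k => V k l)]
  field_simp
  ring

/-- Summation by parts in the second index. -/
theorem brk_fd2_add_bd2 {h : ℝ} (hh : h ≠ 0) (U V : ℕ → ℕ → ℝ) (M p P : ℕ) :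
    brk h (fun k l => fd2 h U k l + bd2 h U k l) V p 1 P M =
      -(brk h U (fd2 h V) p 0 P M + brk h U (bd2 h V) p 1 P (M + 1)) +
        h / 2 * ∑ k ∈ Finset.Icc p P,
          ((U k M + U k (M + 1)) * V k (M + 1) - (U k 0 + U k 1) * V k 0) := by
  simp only [brk_transpose h _ _ p]
  exact brk_fd1_add_bd1 hh (fun k l => U l k) (fun k l => V l k) M p P

theorem brk_eq_two_mul {h : ℝ} {F F' : ℕ → ℕ → ℝ} (hF : ∀ k l, F k l = 2 * F' k l)
    (G : ℕ → ℕ → ℝ) (p q P Q : ℕ) : brk h F G p q P Q = 2 * brk h F' G p q P Q := by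
  simp only [brk, hF, mul_assoc, ← Finset.mul_sum]
  ring

/-- **Discrete Green formula** (Lemma on the grid Green formula), together with the
observation that the left-hand side equals `2[(U_{c.},V)_h + (U_{.c},V)_h]`. -/
theorem discrete_green_formula (N : ℕ) (hN : 1 ≤ N) (h : ℝ) (hh : 0 < h)
    (U V : ℕ → ℕ → ℝ) :
    (brk h (fun k l => fd1 h U k l + bd1 h U k l) V 1 1 (2 * N - 1) (2 * N - 1) +
      brk h (fun k l => fd2 h U k l + bd2 h U k l) V 1 1 (2 * N - 1) (2 * N - 1) =
      -(cdot1 h N U V + cdot2 h N U V) +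
        h / 2 * (∑ l ∈ Finset.Icc 1 (2 * N - 1),
          ((U (2 * N - 1) l + U (2 * N) l) * V (2 * N) l - (U 0 l + U 1 l) * V 0 l)) +
        h / 2 * (∑ k ∈ Finset.Icc 1 (2 * N - 1),
          ((U k (2 * N - 1) + U k (2 * N)) * V k (2 * N) - (U k 0 + U k 1) * V k 0))) ∧
    (brk h (fun k l => fd1 h U k l + bd1 h U k l) V 1 1 (2 * N - 1) (2 * N - 1) +
      brk h (fun k l => fd2 h U k l + bd2 h U k l) V 1 1 (2 * N - 1) (2 * N - 1) =
      2 * (iph h N (cd1 h U) V + iph h N (cd2 h U) V)) := by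
  have hM : 2 * N - 1 + 1 = 2 * N := by omega
  constructor
  · rw [brk_fd1_add_bd1 hh.ne', brk_fd2_add_bd2 hh.ne', hM]
    unfold cdot1 cdot2
    ring
  · rw [brk_eq_two_mul (F := fun k l => fd1 h U k l + bd1 h U k l) (F' := cd1 h U)
         (fun k l => by unfold cd1; ring),
      brk_eq_two_mul (F := fun k l => fd2 h U k l + bd2 h U k l) (F' := cd2 h U)
         (fun k l => by unfold cd2; ring), ← mul_add]
    rfl

end
end
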